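/- Similarity is preserved into normal forms: if suspension terms t and t' are similar (t ∼ t'), then their unique normal forms with respect to the reading and merging rules are equal; if environments e and e' are similar, then they rewrite by reading and merging rules to similar simple environments. -/

import Mathlib

/- Terms of the suspension calculus: constants, de Bruijn indices `#i`,
applications, abstractions, and suspensions `[t, ol, nl, e]`. -/
mutual
inductive Tm : Type where
  | const : Nat → Tm
  | idx : Nat → Tm
  | app : Tm → Tm → Tm
  | lam : Tm → Tm
  | susp : Tm → Nat → Nat → Env → Tm
/-- Environments: `nil`, cons cells `(t,n)::e`, and merges `{e1, nl1, ol2, e2}`. -/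
inductive Env : Type where
  | nil : Env
  | econs : Tm → Nat → Env → Env
  | merge : Env → Nat → Nat → Env → Env
end

/-- Length of an environment. -/
def Env.len : Env → Nat
  | .nil => 0
  | .econs _ _ e => 1 + Env.len e
  | .merge e1 nl1 _ e2 => Env.len e1 + (Env.len e2 - nl1)

/-- Level of an environment. -/
def Env.lev : Env → Nat
  | .nil => 0
  | .econs _ l _ => l
  | .merge _ nl1 ol2 e2 => Env.lev e2 + (nl1 - ol2)

/- Well-formedness of suspension expressions. -/
mutual
inductive WfTm : Tm → Prop where
  | const : ∀ c, WfTm (.const c)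
  | idx : ∀ i, 1 ≤ i → WfTm (.idx i)
  | app : ∀ {t1 t2}, WfTm t1 → WfTm t2 → WfTm (.app t1 t2)
  | lam : ∀ {t}, WfTm t → WfTm (.lam t)
  | susp : ∀ {t e} (ol nl : Nat), WfTm t → WfEnv e → Env.len e = ol →
      Env.lev e ≤ nl → WfTm (.susp t ol nl e)
inductive WfEnv : Env → Prop where
  | nil : WfEnv .nil
  | econs : ∀ {t e} (l : Nat), WfTm t → WfEnv e → Env.lev e ≤ l → WfEnv (.econs t l e)
  | merge : ∀ {e1 e2} (nl1 ol2 : Nat), WfEnv e1 → WfEnv e2 → Env.lev e1 ≤ nl1 →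
      Env.len e2 = ol2 → WfEnv (.merge e1 nl1 ol2 e2)
end

/- One-step rewriting by the reading rules (r1)-(r6) and merging rules
(m1)-(m6), applied at any subexpression. -/
mutual
inductive SR : Tm → Tm → Prop where
  | r1 : ∀ c ol nl e, SR (.susp (.const c) ol nl e) (.const c)
  | r2 : ∀ i nl, 1 ≤ i → SR (.susp (.idx i) 0 nl .nil) (.idx (i + nl))
  | r3 : ∀ ol nl t l e, SR (.susp (.idx 1) ol nl (.econs t l e)) (.susp t 0 (nl - l) .nil)
  | r4 : ∀ i ol nl t l e, 1 < i →
      SR (.susp (.idx i) ol nl (.econs t l e)) (.susp (.idx (i - 1)) (ol - 1) nl e)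
  | r5 : ∀ t1 t2 ol nl e,
      SR (.susp (.app t1 t2) ol nl e) (.app (.susp t1 ol nl e) (.susp t2 ol nl e))
  | r6 : ∀ t ol nl e,
      SR (.susp (.lam t) ol nl e)
         (.lam (.susp t (ol + 1) (nl + 1) (.econs (.idx 1) (nl + 1) e)))
  | m1 : ∀ t ol1 nl1 e1 ol2 nl2 e2,
      SR (.susp (.susp t ol1 nl1 e1) ol2 nl2 e2)
         (.susp t (ol1 + (ol2 - nl1)) (nl2 + (nl1 - ol2)) (.merge e1 nl1 ol2 e2))
  | appL : ∀ {t1 t1'} (t2 : Tm), SR t1 t1' → SR (.app t1 t2) (.app t1' t2)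
  | appR : ∀ (t1 : Tm) {t2 t2'}, SR t2 t2' → SR (.app t1 t2) (.app t1 t2')
  | lamC : ∀ {t t'}, SR t t' → SR (.lam t) (.lam t')
  | suspT : ∀ {t t'} ol nl e, SR t t' → SR (.susp t ol nl e) (.susp t' ol nl e)
  | suspE : ∀ t ol nl {e e'}, SRE e e' → SR (.susp t ol nl e) (.susp t ol nl e')
inductive SRE : Env → Env → Prop where
  | m2 : ∀ e1 nl1, SRE (.merge e1 nl1 0 .nil) e1
  | m3 : ∀ ol2 e2, SRE (.merge .nil 0 ol2 e2) e2
  | m4 : ∀ nl1 ol2 t l e2, 1 ≤ nl1 →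
      SRE (.merge .nil nl1 ol2 (.econs t l e2)) (.merge .nil (nl1 - 1) (ol2 - 1) e2)
  | m5 : ∀ t n e1 nl1 ol2 s l e2, n < nl1 →
      SRE (.merge (.econs t n e1) nl1 ol2 (.econs s l e2))
          (.merge (.econs t n e1) (nl1 - 1) (ol2 - 1) e2)
  | m6 : ∀ t n e1 ol2 s l e2,
      SRE (.merge (.econs t n e1) n ol2 (.econs s l e2))
          (.econs (.susp t ol2 l (.econs s l e2)) (l + (n - ol2))
                  (.merge e1 n ol2 (.econs s l e2)))
  | consT : ∀ {t t'} l e, SR t t' → SRE (.econs t l e) (.econs t' l e)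
  | consE : ∀ t l {e e'}, SRE e e' → SRE (.econs t l e) (.econs t l e')
  | mergeL : ∀ {e1 e1'} nl1 ol2 e2, SRE e1 e1' →
      SRE (.merge e1 nl1 ol2 e2) (.merge e1' nl1 ol2 e2)
  | mergeR : ∀ e1 nl1 ol2 {e2 e2'}, SRE e2 e2' →
      SRE (.merge e1 nl1 ol2 e2) (.merge e1 nl1 ol2 e2')
end

/-- Simple environments: nil-terminated lists of bindings (no merges). -/
inductive SimpleEnv : Env → Prop where
  | nil : SimpleEnv .nil
  | econs : ∀ t l {e}, SimpleEnv e → SimpleEnv (.econs t l e)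

/- The similarity relation on terms and environments: congruence plus the
trading of renumbering between a suspension's new embedding level and the
index of the environment item containing it (preserving the difference k). -/
mutual
inductive SimT : Tm → Tm → Prop where
  | refl : ∀ t, SimT t t
  | app : ∀ {t1 t1' t2 t2'}, SimT t1 t1' → SimT t2 t2' →
      SimT (.app t1 t2) (.app t1' t2')
  | lam : ∀ {t t'}, SimT t t' → SimT (.lam t) (.lam t')
  | susp : ∀ {t t' e e'} (ol nl : Nat), SimT t t' → SimE e e' →
      SimT (.susp t ol nl e) (.susp t' ol nl e')
inductive SimE : Env → Env → Prop where
  | refl : ∀ e, SimE e e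
  | econs : ∀ {t t' e e'} (n : Nat), SimT t t' → SimE e e' →
      SimE (.econs t n e) (.econs t' n e')
  | merge : ∀ {e1 e1' e2 e2'} (nl1 ol2 : Nat), SimE e1 e1' → SimE e2 e2' →
      SimE (.merge e1 nl1 ol2 e2) (.merge e1' nl1 ol2 e2')
  | key : ∀ {t t' r r' e e'} (ol nl nl' k : Nat),
      SimT t t' → SimE r r' → SimE e e' →
      SimE (.econs (.susp t ol nl r) (nl + k) e)
           (.econs (.susp t' ol nl' r') (nl' + k) e')
end

/-- A term is in normal form w.r.t. the reading and merging rules. -/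
def NormalT (t : Tm) : Prop := ∀ u, ¬ SR t u


/-! ## Semantics: pure de Bruijn terms with simultaneous substitutions -/

inductive PTm : Type where
  | const : Nat → PTm
  | var : Nat → PTm
  | app : PTm → PTm → PTm
  | lam : PTm → PTm

namespace PTm

def upr (r : Nat → Nat) : Nat → Nat
  | 0 => 0
  | i + 1 => r i + 1

def ren : (Nat → Nat) → PTm → PTm
  | _, const c => const c
  | r, var i => var (r i)
  | r, app a b => app (ren r a) (ren r b)
  | r, lam a => lam (ren (upr r) a)

def up (s : Nat → PTm) : Nat → PTm
  | 0 => var 0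
  | i + 1 => ren Nat.succ (s i)

def sub : (Nat → PTm) → PTm → PTm
  | _, const c => const c
  | s, var i => s i
  | s, app a b => app (sub s a) (sub s b)
  | s, lam a => lam (sub (up s) a)

def shift (k : Nat) (t : PTm) : PTm := sub (fun i => var (i + k)) t

theorem up_var (r : Nat → Nat) : up (fun i => var (r i)) = fun i => var (upr r i) := by
  funext i; cases i <;> rfl

theorem ren_eq_sub (t : PTm) : ∀ r, ren r t = sub (fun i => var (r i)) t := by
  induction t with
  | const c => intro r; rfl
  | var i => intro r; rfl
  | app a b iha ihb => intro r; simp [ren, sub, iha, ihb]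
  | lam a ih => intro r; simp [ren, sub, ih, up_var]

theorem sub_var (t : PTm) : sub var t = t := by
  have h : up var = var := by funext i; cases i <;> rfl
  induction t with
  | const c => rfl
  | var i => rfl
  | app a b iha ihb => simp [sub, iha, ihb]
  | lam a ih => simp [sub, h, ih]

theorem sub_ren (t : PTm) : ∀ r s, sub s (ren r t) = sub (fun i => s (r i)) t := by
  induction t with
  | const c => intro r s; rfl
  | var i => intro r s; rfl
  | app a b iha ihb => intro r s; simp [ren, sub, iha, ihb]
  | lam a ih =>
    intro r s
    have h : (fun i => up s (upr r i)) = up (fun i => s (r i)) := by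
      funext i; cases i <;> rfl
    simp [ren, sub, ih, h]

theorem ren_ren (t : PTm) : ∀ r q, ren q (ren r t) = ren (fun i => q (r i)) t := by
  intro r q
  rw [ren_eq_sub (ren r t), sub_ren, ← ren_eq_sub t (fun i => q (r i))]

theorem ren_sub (t : PTm) : ∀ r s, ren r (sub s t) = sub (fun i => ren r (s i)) t := by
  induction t with
  | const c => intro r s; rfl
  | var i => intro r s; rfl
  | app a b iha ihb => intro r s; simp [ren, sub, iha, ihb]
  | lam a ih =>
    intro r s
    have h : (fun i => ren (upr r) (up s i)) = up (fun i => ren r (s i)) := by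
      funext i; cases i with
      | zero => rfl
      | succ i => simp [up, ren_ren, upr]
    simp [ren, sub, ih, h]

theorem sub_sub (t : PTm) : ∀ s q, sub q (sub s t) = sub (fun i => sub q (s i)) t := by
  induction t with
  | const c => intro s q; rfl
  | var i => intro s q; rfl
  | app a b iha ihb => intro s q; simp [sub, iha, ihb]
  | lam a ih =>
    intro s q
    have h : (fun i => sub (up q) (up s i)) = up (fun i => sub q (s i)) := by
      funext i; cases i with
      | zero => rfl
      | succ i => simp [up, sub_ren, ren_sub]
    simp [sub, ih, h]

theorem shift_zero (t : PTm) : shift 0 t = t := sub_var t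

theorem shift_shift (a b : Nat) (t : PTm) : shift a (shift b t) = shift (b + a) t := by
  simp [shift, sub_sub, sub, Nat.add_assoc]

theorem shift_sub (k : Nat) (s : Nat → PTm) (t : PTm) :
    shift k (sub s t) = sub (fun i => shift k (s i)) t := sub_sub t _ _

theorem sub_shift (k : Nat) (s : Nat → PTm) (t : PTm) :
    sub s (shift k t) = sub (fun i => s (i + k)) t := sub_sub t _ _

theorem shift_one (t : PTm) : shift 1 t = ren Nat.succ t := (ren_eq_sub t Nat.succ).symm

end PTm

open PTm in
mutual
def denT : Tm → PTm
  | .const c => .const c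
  | .idx i => .var (i - 1)
  | .app a b => .app (denT a) (denT b)
  | .lam a => .lam (denT a)
  | .susp t _ nl e => sub (denE e nl) (denT t)
def denE : Env → Nat → Nat → PTm
  | .nil, L, i => .var (i + L)
  | .econs t l _, L, 0 => shift (L - l) (denT t)
  | .econs _ _ e, L, i + 1 => denE e L i
  | .merge e1 nl1 ol2 e2, L, i => sub (denE e2 (L - (nl1 - ol2))) (denE e1 nl1 i)
end

open PTm

theorem denE_shift : ∀ (e : Env), WfEnv e → ∀ L k i, Env.lev e ≤ L →
    denE e (L + k) i = shift k (denE e L i)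
  | .nil, _, L, k, i, _ => by simp [denE, shift, sub, Nat.add_assoc]
  | .econs t l e, h, L, k, i, hL => by
    cases h with
    | econs _ ht he hl =>
    simp only [Env.lev] at hL
    cases i with
    | zero =>
      simp only [denE, shift_shift]
      congr 1; omega
    | succ i => simpa only [denE] using denE_shift e he L k i (by omega)
  | .merge e1 nl1 ol2 e2, h, L, k, i, hL => by
    cases h with
    | merge _ _ h1 h2 hl hn =>
    simp only [Env.lev] at hL
    simp only [denE, shift_sub]
    congr 1
    funext j
    rw [← denE_shift e2 h2 _ k j (by omega)]
    congr 1; omega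

theorem denE_shift_of_le {e : Env} (h : WfEnv e) {M L : Nat} (hM : Env.lev e ≤ M) (hL : M ≤ L)
    (i : Nat) : denE e L i = shift (L - M) (denE e M i) := by
  rw [← denE_shift e h M (L - M) i hM]
  congr 1; omega

mutual
theorem SR_wf : ∀ {t t' : Tm}, SR t t' → WfTm t → WfTm t'
  | _, _, .r1 c ol nl e, _ => .const c
  | _, _, .r2 i nl hi, _ => .idx _ (by omega)
  | _, _, .r3 ol nl t l e, h => by
    cases h with
    | susp _ _ ht he hol hnl =>
    cases he with
    | econs _ ht he hl =>
    exact .susp _ _ ht .nil rfl (Nat.zero_le _)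
  | _, _, .r4 i ol nl t l e hi, h => by
    cases h with
    | susp _ _ ht he hol hnl =>
    cases he with
    | econs _ ht he hl =>
    simp only [Env.len, Env.lev] at hol hnl
    exact .susp _ _ (.idx _ (by omega)) he (by omega) (by omega)
  | _, _, .r5 t1 t2 ol nl e, h => by
    cases h with
    | susp _ _ ht he hol hnl =>
    cases ht with
    | app h1 h2 =>
    exact .app (.susp _ _ h1 he hol hnl) (.susp _ _ h2 he hol hnl)
  | _, _, .r6 t ol nl e, h => by
    cases h with
    | susp _ _ ht he hol hnl =>
    cases ht with
    | lam ht =>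
    exact .lam (.susp _ _ ht (.econs _ (.idx _ (by omega)) he (by omega))
      (by simp only [Env.len]; omega) (by simp [Env.lev]))
  | _, _, .m1 t ol1 nl1 e1 ol2 nl2 e2, h => by
    cases h with
    | susp _ _ ht he hol hnl =>
    cases ht with
    | susp _ _ ht he' hol' hnl' =>
    exact .susp _ _ ht (.merge _ _ he' he hnl' hol)
      (by simp only [Env.len]; omega) (by simp only [Env.lev]; omega)
  | _, _, .appL t2 h1, h => by
    cases h with
    | app ha hb => exact .app (SR_wf h1 ha) hb
  | _, _, .appR t1 h1, h => by
    cases h with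
    | app ha hb => exact .app ha (SR_wf h1 hb)
  | _, _, .lamC h1, h => by
    cases h with
    | lam ha => exact .lam (SR_wf h1 ha)
  | _, _, .suspT ol nl e h1, h => by
    cases h with
    | susp _ _ ht he hol hnl => exact .susp _ _ (SR_wf h1 ht) he hol hnl
  | _, _, .suspE t ol nl h1, h => by
    cases h with
    | susp _ _ ht he hol hnl =>
    have := SRE_wf h1 he
    exact .susp _ _ ht this.1 (by omega) (by omega)
theorem SRE_wf : ∀ {e e' : Env}, SRE e e' → WfEnv e →
    WfEnv e' ∧ Env.lev e' ≤ Env.lev e ∧ Env.len e' = Env.len e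
  | _, _, .m2 e1 nl1, h => by
    cases h with
    | merge _ _ h1 h2 hl hn => exact ⟨h1, by simp only [Env.lev]; omega, by simp [Env.len]⟩
  | _, _, .m3 ol2 e2, h => by
    cases h with
    | merge _ _ h1 h2 hl hn => exact ⟨h2, by simp [Env.lev], by simp [Env.len]⟩
  | _, _, .m4 nl1 ol2 t l e2 hp, h => by
    cases h with
    | merge _ _ h1 h2 hl hn =>
    cases h2 with
    | econs _ ht he hl2 =>
    simp only [Env.len, Env.lev] at *
    exact ⟨.merge _ _ h1 he (by simp [Env.lev]) (by omega), by omega, by omega⟩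
  | _, _, .m5 t n e1 nl1 ol2 s l e2 hp, h => by
    cases h with
    | merge _ _ h1 h2 hl hn =>
    cases h2 with
    | econs _ ht he hl2 =>
    simp only [Env.len, Env.lev] at *
    exact ⟨.merge _ _ h1 he (by simp only [Env.lev]; omega) (by omega), by omega, by omega⟩
  | _, _, .m6 t n e1 ol2 s l e2, h => by
    cases h with
    | merge _ _ h1 h2 hl hn =>
    cases h1 with
    | econs _ ht he hl1 =>
    refine ⟨.econs _ (.susp _ _ ht h2 hn (Nat.le_refl _)) (.merge _ _ he h2 hl1 hn) ?_, ?_, ?_⟩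
    · simp [Env.lev]
    · simp [Env.lev]
    · simp only [Env.len]; omega
  | _, _, .consT l e h1, h => by
    cases h with
    | econs _ ht he hl => exact ⟨.econs _ (SR_wf h1 ht) he hl, Nat.le_refl _, rfl⟩
  | _, _, .consE t l h1, h => by
    cases h with
    | econs _ ht he hl =>
    have := SRE_wf h1 he
    exact ⟨.econs _ ht this.1 (by omega), Nat.le_refl _, by simp only [Env.len]; omega⟩
  | _, _, .mergeL nl1 ol2 e2 h1, h => by
    cases h with
    | merge _ _ ha hb hl hn =>
    have := SRE_wf h1 ha
    exact ⟨.merge _ _ this.1 hb (by omega) hn, Nat.le_refl _, by simp only [Env.len]; omega⟩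
  | _, _, .mergeR e1 nl1 ol2 h1, h => by
    cases h with
    | merge _ _ ha hb hl hn =>
    have := SRE_wf h1 hb
    exact ⟨.merge _ _ ha this.1 hl (by omega), by simp only [Env.lev]; omega,
      by simp only [Env.len]; omega⟩
end

mutual
theorem SR_den : ∀ {t t' : Tm}, SR t t' → WfTm t → denT t = denT t'
  | _, _, .r1 c ol nl e, _ => rfl
  | _, _, .r2 i nl hi, _ => by
    simp only [denT, sub, denE]; congr 1; omega
  | _, _, .r3 ol nl t l e, h => by
    simp only [denT, sub, denE, Nat.sub_self, shift]
  | _, _, .r4 i ol nl t l e hi, h => by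
    obtain ⟨j, rfl⟩ : ∃ j, i = j + 2 := ⟨i - 2, by omega⟩
    rfl
  | _, _, .r5 t1 t2 ol nl e, h => rfl
  | _, _, .r6 t ol nl e, h => by
    cases h with
    | susp _ _ ht he hol hnl =>
    simp only [denT, sub]
    congr 2
    funext i
    cases i with
    | zero => simp [up, denE, denT, shift_zero]
    | succ i => simp only [up, denE]; rw [denE_shift e he nl 1 i hnl, shift_one]
  | _, _, .m1 t ol1 nl1 e1 ol2 nl2 e2, h => by
    simp only [denT, PTm.sub_sub]
    congr 1
    funext i
    simp [denE]
  | _, _, .appL t2 h1, h => by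
    cases h with
    | app ha hb => simp only [denT, SR_den h1 ha]
  | _, _, .appR t1 h1, h => by
    cases h with
    | app ha hb => simp only [denT, SR_den h1 hb]
  | _, _, .lamC h1, h => by
    cases h with
    | lam ha => simp only [denT, SR_den h1 ha]
  | _, _, .suspT ol nl e h1, h => by
    cases h with
    | susp _ _ ht he hol hnl => simp only [denT, SR_den h1 ht]
  | _, _, .suspE t ol nl h1, h => by
    cases h with
    | susp _ _ ht he hol hnl =>
    simp only [denT]
    congr 1
    funext i
    exact SRE_den h1 he nl i hnl
theorem SRE_den : ∀ {e e' : Env}, SRE e e' → WfEnv e → ∀ L i, Env.lev e ≤ L →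
    denE e L i = denE e' L i
  | _, _, .m2 e1 nl1, h, L, i, hL => by
    cases h with
    | merge _ _ h1 h2 hl hn =>
    simp only [Env.lev] at hL
    rw [denE_shift_of_le h1 hl (by omega : nl1 ≤ L)]
    simp only [denE, shift, Nat.sub_zero]
  | _, _, .m3 ol2 e2, h, L, i, hL => by
    simp [denE, sub]
  | _, _, .m4 nl1 ol2 t l e2 hp, h, L, i, hL => by
    cases h with
    | merge _ _ h1 h2 hl hn =>
    simp only [Env.len] at hn
    obtain ⟨m, rfl⟩ : ∃ m, nl1 = m + 1 := ⟨nl1 - 1, by omega⟩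
    obtain ⟨o, rfl⟩ : ∃ o, ol2 = o + 1 := ⟨ol2 - 1, by omega⟩
    simp only [denE, sub, ← Nat.add_assoc, Nat.add_sub_add_right, Nat.add_sub_cancel]
  | _, _, .m5 t n e1 nl1 ol2 s l e2 hp, h, L, i, hL => by
    cases h with
    | merge _ _ h1 h2 hl hn =>
    simp only [Env.len] at hn
    obtain ⟨m, rfl⟩ : ∃ m, nl1 = m + 1 := ⟨nl1 - 1, by omega⟩
    obtain ⟨o, rfl⟩ : ∃ o, ol2 = o + 1 := ⟨ol2 - 1, by omega⟩
    rw [denE.eq_4, denE.eq_4, denE_shift _ h1 m 1 i (by simp only [Env.lev]; omega), sub_shift]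
    simp only [Nat.add_sub_add_right, Nat.add_sub_cancel]
    rfl
  | _, _, .m6 t n e1 ol2 s l e2, h, L, i, hL => by
    cases h with
    | merge _ _ h1 h2 hl hn =>
    simp only [Env.lev] at hL
    cases i with
    | zero =>
      rw [denE.eq_4]
      simp only [denE.eq_2, Nat.sub_self, shift_zero, denT, shift_sub]
      congr 1
      funext j
      rw [denE_shift_of_le h2 (M := l) (Nat.le_refl _) (by omega)]
      congr 1; omega
    | succ i => simp only [denE]
  | _, _, .consT l e h1, h, L, i, hL => by
    cases h with
    | econs _ ht he hl =>
    cases i with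
    | zero => simp only [denE, SR_den h1 ht]
    | succ i => rfl
  | _, _, .consE t l h1, h, L, i, hL => by
    cases h with
    | econs _ ht he hl =>
    simp only [Env.lev] at hL
    cases i with
    | zero => rfl
    | succ i => simpa only [denE] using SRE_den h1 he L i (by omega)
  | _, _, .mergeL nl1 ol2 e2 h1, h, L, i, hL => by
    cases h with
    | merge _ _ ha hb hl hn =>
    simp only [denE]
    rw [SRE_den h1 ha nl1 i hl]
  | _, _, .mergeR e1 nl1 ol2 h1, h, L, i, hL => by
    cases h with
    | merge _ _ ha hb hl hn =>
    simp only [Env.lev] at hL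
    simp only [denE]
    congr 1
    funext j
    exact SRE_den h1 hb _ j (by omega)
end

mutual
theorem SimT_den : ∀ {t t' : Tm}, SimT t t' → WfTm t → WfTm t' → denT t = denT t'
  | _, _, .refl t, _, _ => rfl
  | _, _, .app h1 h2, h, h' => by
    cases h with
    | app ha hb =>
    cases h' with
    | app ha' hb' => simp only [denT, SimT_den h1 ha ha', SimT_den h2 hb hb']
  | _, _, .lam h1, h, h' => by
    cases h with
    | lam ha =>
    cases h' with
    | lam ha' => simp only [denT, SimT_den h1 ha ha']
  | _, _, .susp ol nl h1 h2, h, h' => by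
    cases h with
    | susp _ _ ht he hol hnl =>
    cases h' with
    | susp _ _ ht' he' hol' hnl' =>
    simp only [denT, SimT_den h1 ht ht']
    congr 1
    funext i
    exact SimE_den h2 he he' nl i hnl hnl'
theorem SimE_den : ∀ {e e' : Env}, SimE e e' → WfEnv e → WfEnv e' → ∀ L i,
    Env.lev e ≤ L → Env.lev e' ≤ L → denE e L i = denE e' L i
  | _, _, .refl e, _, _, _, _, _, _ => rfl
  | _, _, .econs n h1 h2, h, h', L, i, hL, hL' => by
    cases h with
    | econs _ ht he hl =>
    cases h' with
    | econs _ ht' he' hl' =>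
    simp only [Env.lev] at hL hL'
    cases i with
    | zero => simp only [denE, SimT_den h1 ht ht']
    | succ i => simpa only [denE] using SimE_den h2 he he' L i (by omega) (by omega)
  | _, _, .merge nl1 ol2 h1 h2, h, h', L, i, hL, hL' => by
    cases h with
    | merge _ _ ha hb hl hn =>
    cases h' with
    | merge _ _ ha' hb' hl' hn' =>
    simp only [Env.lev] at hL hL'
    simp only [denE]
    rw [SimE_den h1 ha ha' nl1 i hl hl']
    congr 1
    funext j
    exact SimE_den h2 hb hb' _ j (by omega) (by omega)
  | _, _, .key (r := r) (r' := r') ol nl nl' k h1 h2 h3, h, h', L, i, hL, hL' => by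
    cases h with
    | econs _ ht he hl =>
    cases h' with
    | econs _ ht' he' hl' =>
    simp only [Env.lev] at hL hL'
    cases i with
    | zero =>
      cases ht with
      | susp _ _ ht hr hol hnl =>
      cases ht' with
      | susp _ _ ht' hr' hol' hnl' =>
      simp only [denE, denT, SimT_den h1 ht ht', shift_sub]
      congr 1
      funext j
      have e1 := denE_shift_of_le hr hnl (by omega : nl ≤ L - k) j
      have e2 := denE_shift_of_le hr' hnl' (by omega : nl' ≤ L - k) j
      have e3 := SimE_den h2 hr hr' (L - k) j (by omega) (by omega)
      rw [e1, e2] at e3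
      have a1 : L - (nl + k) = L - k - nl := by omega
      have a2 : L - (nl' + k) = L - k - nl' := by omega
      rw [a1, a2]
      exact e3
    | succ i => simpa only [denE] using SimE_den h3 he he' L i (by omega) (by omega)
end

/-! ## Normal forms -/

theorem merge_red : ∀ (e : Env), WfEnv e → ∀ e1 nl1 ol2 e2, e = .merge e1 nl1 ol2 e2 →
    ∃ f, SRE e f
  | .nil, _, _, _, _, _, he => by cases he
  | .econs _ _ _, _, _, _, _, _, he => by cases he
  | .merge e1 nl1 ol2 e2, h, _, _, _, _, _ => by
    cases h with
    | merge _ _ ha hb hl hn =>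
    cases h1 : e1 with
    | merge a b c d =>
      obtain ⟨f, hf⟩ := merge_red e1 ha _ _ _ _ h1
      subst h1
      exact ⟨_, .mergeL _ _ _ hf⟩
    | nil =>
      cases h2 : e2 with
      | merge a b c d =>
        obtain ⟨f, hf⟩ := merge_red e2 hb _ _ _ _ h2
        subst h2
        exact ⟨_, .mergeR _ _ _ hf⟩
      | nil => subst h2; subst hn; exact ⟨_, .m2 _ _⟩
      | econs s l d =>
        rcases Nat.eq_zero_or_pos nl1 with h0 | h0
        · subst h0; exact ⟨_, .m3 _ _⟩
        · exact ⟨_, .m4 _ _ _ _ _ h0⟩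
    | econs t n e1' =>
      cases h2 : e2 with
      | merge a b c d =>
        obtain ⟨f, hf⟩ := merge_red e2 hb _ _ _ _ h2
        subst h2
        exact ⟨_, .mergeR _ _ _ hf⟩
      | nil => subst h2; subst hn; exact ⟨_, .m2 _ _⟩
      | econs s l d =>
        subst h1
        simp only [Env.lev] at hl
        rcases Nat.eq_or_lt_of_le hl with h0 | h0
        · subst h0; exact ⟨_, .m6 _ _ _ _ _ _ _⟩
        · exact ⟨_, .m5 _ _ _ _ _ _ _ _ h0⟩

theorem susp_red {t : Tm} {ol nl : Nat} {e : Env} (h : WfTm (.susp t ol nl e)) :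
    ∃ u, SR (.susp t ol nl e) u := by
  cases h with
  | susp _ _ ht he hol hnl =>
  cases t with
  | const c => exact ⟨_, .r1 _ _ _ _⟩
  | app a b => exact ⟨_, .r5 _ _ _ _ _⟩
  | lam a => exact ⟨_, .r6 _ _ _ _⟩
  | susp a b c d => exact ⟨_, .m1 _ _ _ _ _ _ _⟩
  | idx i =>
    cases ht with
    | idx _ hi =>
    cases h2 : e with
    | nil => subst h2; subst hol; exact ⟨_, .r2 _ _ hi⟩
    | econs s l d =>
      rcases Nat.eq_or_lt_of_le hi with h0 | h0
      · subst h0; exact ⟨_, .r3 _ _ _ _ _⟩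
      · exact ⟨_, .r4 _ _ _ _ _ _ h0⟩
    | merge a b c d =>
      obtain ⟨f, hf⟩ := merge_red e he _ _ _ _ h2
      subst h2
      exact ⟨_, .suspE _ _ _ hf⟩

theorem normal_inj : ∀ (u u' : Tm), WfTm u → WfTm u' → NormalT u → NormalT u' →
    denT u = denT u' → u = u'
  | .susp _ _ _ _, _, h, _, n, _, _ => by
    obtain ⟨v, hv⟩ := susp_red h
    exact absurd hv (n v)
  | _, .susp _ _ _ _, _, h, _, n, _ => by
    obtain ⟨v, hv⟩ := susp_red h
    exact absurd hv (n v)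
  | .const c, .const d, _, _, _, _, he => by
    simp only [denT, PTm.const.injEq] at he; rw [he]
  | .idx i, .idx j, h, h', _, _, he => by
    simp only [denT, PTm.var.injEq] at he
    cases h with
    | idx _ hi =>
    cases h' with
    | idx _ hj =>
    congr 1; omega
  | .app a b, .app a' b', h, h', n, n', he => by
    simp only [denT, PTm.app.injEq] at he
    cases h with
    | app ha hb =>
    cases h' with
    | app ha' hb' =>
    rw [normal_inj a a' ha ha' (fun u hu => n _ (.appL _ hu)) (fun u hu => n' _ (.appL _ hu)) he.1,
      normal_inj b b' hb hb' (fun u hu => n _ (.appR _ hu)) (fun u hu => n' _ (.appR _ hu)) he.2]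
  | .lam a, .lam a', h, h', n, n', he => by
    simp only [denT, PTm.lam.injEq] at he
    cases h with
    | lam ha =>
    cases h' with
    | lam ha' =>
    rw [normal_inj a a' ha ha' (fun u hu => n _ (.lamC hu)) (fun u hu => n' _ (.lamC hu)) he]
  | .const _, .idx _, _, _, _, _, he => by simp [denT] at he
  | .const _, .app _ _, _, _, _, _, he => by simp [denT] at he
  | .const _, .lam _, _, _, _, _, he => by simp [denT] at he
  | .idx _, .const _, _, _, _, _, he => by simp [denT] at he
  | .idx _, .app _ _, _, _, _, _, he => by simp [denT] at he
  | .idx _, .lam _, _, _, _, _, he => by simp [denT] at he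
  | .app _ _, .const _, _, _, _, _, he => by simp [denT] at he
  | .app _ _, .idx _, _, _, _, _, he => by simp [denT] at he
  | .app _ _, .lam _, _, _, _, _, he => by simp [denT] at he
  | .lam _, .const _, _, _, _, _, he => by simp [denT] at he
  | .lam _, .idx _, _, _, _, _, he => by simp [denT] at he
  | .lam _, .app _ _, _, _, _, _, he => by simp [denT] at he

open Relation

theorem SRs_den {t u : Tm} (h : ReflTransGen SR t u) (hw : WfTm t) :
    WfTm u ∧ denT t = denT u := by
  induction h with
  | refl => exact ⟨hw, rfl⟩
  | tail _ hs ih => exact ⟨SR_wf hs ih.1, ih.2.trans (SR_den hs ih.1)⟩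

theorem SREs_wf {e f : Env} (h : ReflTransGen SRE e f) (hw : WfEnv e) :
    WfEnv f ∧ Env.lev f ≤ Env.lev e ∧ Env.len f = Env.len e := by
  induction h with
  | refl => exact ⟨hw, Nat.le_refl _, rfl⟩
  | tail _ hs ih =>
    have := SRE_wf hs ih.1
    exact ⟨this.1, by omega, by omega⟩

/-! ## Environments -/

/-- Simple environments with non-increasing levels. -/
inductive Srt : Env → Prop where
  | nil : Srt .nil
  | econs : ∀ t l {e}, Srt e → Env.lev e ≤ l → Srt (.econs t l e)

def edrop : Nat → Env → Env
  | 0, e => e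
  | n + 1, .econs _ _ e => edrop n e
  | _ + 1, e => e

theorem edrop_nil (n : Nat) : edrop n .nil = .nil := by cases n <;> rfl

theorem edrop_edrop {g : Env} (hg : Srt g) : ∀ a b, edrop a (edrop b g) = edrop (b + a) g := by
  induction hg with
  | nil => intro a b; simp [edrop_nil]
  | econs t l _ _ ih =>
    intro a b
    cases b with
    | zero => simp [edrop]
    | succ b => rw [Nat.add_right_comm]; exact ih a b

theorem edrop_len {g : Env} (hg : Srt g) : ∀ a, (edrop a g).len = g.len - a := by
  induction hg with
  | nil => intro a; simp [edrop_nil, Env.len]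
  | econs t l _ _ ih =>
    intro a
    cases a with
    | zero => simp [edrop]
    | succ a => simp only [edrop, ih, Env.len]; omega

theorem edrop_srt {g : Env} (hg : Srt g) : ∀ a, Srt (edrop a g) ∧ (edrop a g).lev ≤ g.lev := by
  induction hg with
  | nil => intro a; simp [edrop_nil, Srt.nil]
  | econs t l hs hl ih =>
    intro a
    cases a with
    | zero => exact ⟨.econs _ _ hs hl, Nat.le_refl _⟩
    | succ a =>
      have := ih a
      exact ⟨this.1, by simp only [edrop, Env.lev]; omega⟩

/-- Hereditary similarity of simple environments. -/
inductive HSim : Env → Env → Prop where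
  | nil : HSim .nil .nil
  | econs : ∀ {t t' e e'} (n : Nat), SimT t t' → HSim e e' → Env.lev e ≤ n → Env.lev e' ≤ n →
      HSim (.econs t n e) (.econs t' n e')
  | key : ∀ {t t' r r' e e'} (ol nl nl' k : Nat),
      SimT t t' → HSim r r' → HSim e e' → Env.lev r ≤ nl → Env.lev r' ≤ nl' →
      Env.lev e ≤ nl + k → Env.lev e' ≤ nl' + k →
      HSim (.econs (.susp t ol nl r) (nl + k) e)
           (.econs (.susp t' ol nl' r') (nl' + k) e')

theorem HSim.simE {f f' : Env} (h : HSim f f') : SimE f f' := by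
  induction h with
  | nil => exact .refl _
  | econs n ht _ _ _ ih => exact .econs n ht ih
  | key ol nl nl' k ht _ _ _ _ _ _ ih1 ih2 => exact .key ol nl nl' k ht ih1 ih2

theorem HSim.srt {f f' : Env} (h : HSim f f') : Srt f ∧ Srt f' ∧ f.len = f'.len := by
  induction h with
  | nil => exact ⟨.nil, .nil, rfl⟩
  | econs n ht _ h1 h2 ih =>
    exact ⟨.econs _ _ ih.1 h1, .econs _ _ ih.2.1 h2, by simp only [Env.len, ih.2.2]⟩
  | key ol nl nl' k ht _ _ _ _ h1 h2 _ ih =>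
    exact ⟨.econs _ _ ih.1 h1, .econs _ _ ih.2.1 h2, by simp only [Env.len, ih.2.2]⟩

theorem Srt.simple {f : Env} (h : Srt f) : SimpleEnv f := by
  induction h with
  | nil => exact .nil
  | econs t l _ _ ih => exact .econs t l ih

theorem HSim.drop {g g' : Env} (h : HSim g g') : ∀ a, HSim (edrop a g) (edrop a g') := by
  induction h with
  | nil => intro a; simp [edrop_nil, HSim.nil]
  | econs n ht h h1 h2 ih =>
    intro a
    cases a with
    | zero => exact .econs n ht h h1 h2
    | succ a => exact ih a
  | key ol nl nl' k ht hr h hr1 hr2 h1 h2 _ ih =>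
    intro a
    cases a with
    | zero => exact .key ol nl nl' k ht hr h hr1 hr2 h1 h2
    | succ a => exact ih a

theorem srt_nil_of_len {g : Env} (hg : Srt g) (h : g.len = 0) : g = .nil := by
  cases hg with
  | nil => rfl
  | econs => simp [Env.len] at h

theorem merge_nil_steps {g : Env} (hg : Srt g) : ∀ nl,
    ReflTransGen SRE (.merge .nil nl g.len g) (edrop nl g) := by
  induction hg with
  | nil => intro nl; rw [edrop_nil]; exact .single (.m2 _ _)
  | @econs t l e _ _ ih =>
    intro nl
    cases nl with
    | zero => exact .single (.m3 _ _)
    | succ nl =>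
      refine .head (.m4 _ _ _ _ _ (by omega)) ?_
      have := ih nl
      simpa [Env.len, edrop] using this

theorem merge_cons_nil {g : Env} (hg : Srt g) (t : Tm) (n : Nat) (e : Env) : ∀ nl, n ≤ nl →
    g.len ≤ nl - n → ReflTransGen SRE (.merge (.econs t n e) nl g.len g) (.econs t n e) := by
  induction hg with
  | nil => intro nl _ _; exact .single (.m2 _ _)
  | @econs s l e2 _ _ ih =>
    intro nl hn hl
    simp only [Env.len] at hl
    refine .head (.m5 _ _ _ _ _ _ _ _ (by omega)) ?_
    have := ih (nl - 1) (by omega) (by omega)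
    simpa [Env.len] using this

theorem merge_cons_steps {g : Env} (hg : Srt g) (t : Tm) (n : Nat) (e : Env) : ∀ nl, n ≤ nl →
    nl - n ≤ g.len → ReflTransGen SRE (.merge (.econs t n e) nl g.len g)
      (.merge (.econs t n e) n (edrop (nl - n) g).len (edrop (nl - n) g)) := by
  induction hg with
  | nil =>
    intro nl hn hl
    simp only [Env.len] at hl
    obtain rfl : n = nl := by omega
    rw [edrop_nil]
  | @econs s l e2 _ _ ih =>
    intro nl hn hl
    simp only [Env.len] at hl
    rcases Nat.eq_or_lt_of_le hn with h0 | h0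
    · subst h0; rw [Nat.sub_self]; exact .refl
    · refine .head (.m5 _ _ _ _ _ _ _ _ h0) ?_
      have := ih (nl - 1) (by omega) (by omega)
      obtain ⟨m, hm⟩ : ∃ m, nl - n = m + 1 := ⟨nl - n - 1, by omega⟩
      have hm' : nl - 1 - n = m := by omega
      rw [hm'] at this
      simpa [Env.len, edrop, hm] using this

theorem steps_consE (t : Tm) (l : Nat) {e e' : Env} (h : ReflTransGen SRE e e') :
    ReflTransGen SRE (.econs t l e) (.econs t l e') :=
  h.lift (fun x => Env.econs t l x) (fun _ _ hs => .consE t l hs)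

theorem steps_suspE (t : Tm) (ol nl l : Nat) (d : Env) {e e' : Env} (h : ReflTransGen SRE e e') :
    ReflTransGen SRE (.econs (.susp t ol nl e) l d) (.econs (.susp t ol nl e') l d) :=
  h.lift (fun x => Env.econs (.susp t ol nl x) l d) (fun _ _ hs => .consT l d (.suspE t ol nl hs))

theorem steps_merge {e1 e1' e2 e2' : Env} (nl ol : Nat) (h1 : ReflTransGen SRE e1 e1')
    (h2 : ReflTransGen SRE e2 e2') :
    ReflTransGen SRE (.merge e1 nl ol e2) (.merge e1' nl ol e2') :=
  (h1.lift (fun x => Env.merge x nl ol e2) (fun _ _ hs => .mergeL nl ol e2 hs)).trans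
    (h2.lift (fun x => Env.merge e1' nl ol x) (fun _ _ hs => .mergeR e1' nl ol hs))

/-- What one side of the merge lemma says: `{f, nl, |g|, g}` rewrites to `h`. -/
def MOut (f : Env) (nl : Nat) (g h : Env) : Prop :=
  ReflTransGen SRE (.merge f nl g.len g) h ∧ h.lev ≤ g.lev + (nl - g.len) ∧ (g.len = 0 → h = f)

/-- Everything in `g` is dropped. -/
theorem MOut_none {G : Env} (hG : Srt G) {t : Tm} {n : Nat} {e : Env} {N nl : Nat}
    (hn : n ≤ nl) (hN : nl ≤ N) (hz : (edrop (N - n) G).len = 0) :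
    MOut (.econs t n e) nl (edrop (N - nl) G) (.econs t n e) := by
  have l1 := edrop_len hG (N - n)
  have l2 := edrop_len hG (N - nl)
  refine ⟨merge_cons_nil (edrop_srt hG _).1 t n e nl hn (by omega), ?_, fun _ => rfl⟩
  simp only [Env.lev]; omega

/-- Something in `g` survives. -/
theorem MOut_some {G : Env} (hG : Srt G) {t : Tm} {n : Nat} {e : Env} {N nl : Nat}
    (hn : n ≤ nl) (hN : nl ≤ N) (hz : (edrop (N - n) G).len ≠ 0) {h : Env}
    (hm : ReflTransGen SRE
      (.econs (.susp t (edrop (N - n) G).len (edrop (N - n) G).lev (edrop (N - n) G))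
        ((edrop (N - n) G).lev + (n - (edrop (N - n) G).len))
        (.merge e n (edrop (N - n) G).len (edrop (N - n) G))) h)
    (hl : h.lev = (edrop (N - n) G).lev + (n - (edrop (N - n) G).len)) :
    MOut (.econs t n e) nl (edrop (N - nl) G) h := by
  have l1 := edrop_len hG (N - n)
  have l2 := edrop_len hG (N - nl)
  have hc : edrop (nl - n) (edrop (N - nl) G) = edrop (N - n) G := by
    rw [edrop_edrop hG]; congr 1; omega
  have hs := edrop_srt hG (N - nl)
  have hs2 := (edrop_srt hs.1 (nl - n)).2
  rw [hc] at hs2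
  have st := merge_cons_steps hs.1 t n e nl hn (by omega)
  rw [hc] at st
  refine ⟨st.trans (.trans ?_ hm), by omega, fun h0 => absurd h0 (by omega)⟩
  have hsD := (edrop_srt hG (N - n)).1
  generalize edrop (N - n) G = D at *
  cases hsD with
  | nil => simp [Env.len] at hz
  | econs s l _ _ => exact .single (.m6 _ _ _ _ _ _ _)

theorem arith_both (ol : Nat) {L L' N m m' k d d' : Nat} (h1 : d = L - (N - (m + k)))
    (h2 : d' = L' - (N - (m' + k))) (hL : L = L') (a : m + k ≤ N) (a' : m' + k ≤ N)
    (z : d ≠ 0) (z' : d' ≠ 0) : ol + (d' - m') = ol + (d - m) ∧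
      ∃ j, m + k - d = m - d + j ∧ m' + k - d' = m' - d' + j := by
  subst hL
  exact ⟨by omega, m + k - d - (m - d), by omega, by omega⟩

set_option maxHeartbeats 1000000 in
theorem merge_HSim {f f' : Env} (hf : HSim f f') : ∀ (N nl nl' : Nat) (G G' : Env), HSim G G' →
    nl ≤ N → nl' ≤ N → f.lev ≤ nl → f'.lev ≤ nl' →
    ∃ h h', MOut f nl (edrop (N - nl) G) h ∧ MOut f' nl' (edrop (N - nl') G') h' ∧ HSim h h' := by
  induction hf with
  | nil =>
    intro N nl nl' G G' hG hN hN' _ _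
    obtain ⟨s, s', hlen⟩ := hG.srt
    have key : ∀ {G : Env} {nl : Nat}, Srt G → nl ≤ N →
        MOut .nil nl (edrop (N - nl) G) (edrop N G) := by
      intro G nl s hN
      have hc : edrop nl (edrop (N - nl) G) = edrop N G := by
        rw [edrop_edrop s]; congr 1; omega
      have hs := edrop_srt s (N - nl)
      refine ⟨hc ▸ merge_nil_steps hs.1 nl, ?_, fun h0 => ?_⟩
      · have := (edrop_srt hs.1 nl).2
        rw [hc] at this
        omega
      · rw [← hc, srt_nil_of_len hs.1 h0, edrop_nil]
    exact ⟨_, _, key s hN, key s' hN', hG.drop N⟩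
  | @econs t t' e e' n ht he h1 h2 ih =>
    intro N nl nl' G G' hG hN hN' hl hl'
    simp only [Env.lev] at hl hl'
    obtain ⟨s, s', hlen⟩ := hG.srt
    have hD := hG.drop (N - n)
    have hDl := hD.srt.2.2
    by_cases hz : (edrop (N - n) G).len = 0
    · exact ⟨_, _, MOut_none s hl hN hz, MOut_none s' hl' hN' (hDl ▸ hz), .econs n ht he h1 h2⟩
    · obtain ⟨h, h', ⟨o1, o2, _⟩, ⟨o1', o2', _⟩, hh⟩ :=
        ih N n n G G' hG (by omega) (by omega) h1 h2
      refine ⟨_, _, MOut_some s hl hN hz (steps_consE _ _ o1) rfl,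
        MOut_some s' hl' hN' (hDl ▸ hz) (steps_consE _ _ o1') rfl, ?_⟩
      rw [← hDl] at o2' ⊢
      exact .key _ _ _ _ ht hD hh (Nat.le_refl _) (Nat.le_refl _) o2 o2'
  | @key t t' r r' e e' ol m m' k ht hr he hr1 hr2 h1 h2 ihr ihe =>
    intro N nl nl' G G' hG hN hN' hl hl'
    simp only [Env.lev] at hl hl'
    obtain ⟨s, s', hlen⟩ := hG.srt
    have d1 := edrop_len s (N - (m + k))
    have d2 := edrop_len s' (N - (m' + k))
    obtain ⟨x, x', ⟨p1, p2, p3⟩, ⟨p1', p2', p3'⟩, hx⟩ :=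
      ihr (N - k) m m' G G' hG (by omega) (by omega) hr1 hr2
    obtain ⟨y, y', ⟨q1, q2, q3⟩, ⟨q1', q2', q3'⟩, hy⟩ :=
      ihe N (m + k) (m' + k) G G' hG (by omega) (by omega) h1 h2
    have a1 : N - k - m = N - (m + k) := by omega
    have a2 : N - k - m' = N - (m' + k) := by omega
    rw [a1] at p1 p2 p3
    rw [a2] at p1' p2' p3'
    have big : ∀ {G r e x y : Env} {t : Tm} {m : Nat},
        ReflTransGen SRE (.merge r m (edrop (N - (m + k)) G).len (edrop (N - (m + k)) G)) x →
        ReflTransGen SRE (.merge e (m + k) (edrop (N - (m + k)) G).len (edrop (N - (m + k)) G)) y →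
        ReflTransGen SRE
          (.econs (.susp (.susp t ol m r) (edrop (N - (m + k)) G).len (edrop (N - (m + k)) G).lev
              (edrop (N - (m + k)) G))
            ((edrop (N - (m + k)) G).lev + (m + k - (edrop (N - (m + k)) G).len))
            (.merge e (m + k) (edrop (N - (m + k)) G).len (edrop (N - (m + k)) G)))
          (.econs (.susp t (ol + ((edrop (N - (m + k)) G).len - m))
              ((edrop (N - (m + k)) G).lev + (m - (edrop (N - (m + k)) G).len)) x)
            ((edrop (N - (m + k)) G).lev + (m + k - (edrop (N - (m + k)) G).len)) y) := by
      intro G r e x y t m hx hy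
      exact .head (.consT _ _ (.m1 _ _ _ _ _ _ _))
        ((steps_suspE _ _ _ _ _ hx).trans (steps_consE _ _ hy))
    by_cases hz : (edrop (N - (m + k)) G).len = 0
    · by_cases hz' : (edrop (N - (m' + k)) G').len = 0
      · exact ⟨_, _, MOut_none s hl hN hz, MOut_none s' hl' hN' hz',
          .key ol m m' k ht hr he hr1 hr2 h1 h2⟩
      · refine ⟨_, _, MOut_none s hl hN hz, MOut_some s' hl' hN' hz' (big p1' q1') rfl, ?_⟩
        rw [p3 hz] at hx
        rw [q3 hz] at hy
        generalize edrop (N - (m' + k)) G' = D' at *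
        have e1 : ol + (D'.len - m') = ol := by omega
        have e2 : D'.lev + (m' + k - D'.len) = D'.lev + (m' - D'.len) + k := by omega
        rw [e1, e2]
        rw [e2] at q2'
        exact .key _ _ _ _ ht hx hy hr1 p2' h1 q2'
    · by_cases hz' : (edrop (N - (m' + k)) G').len = 0
      · refine ⟨_, _, MOut_some s hl hN hz (big p1 q1) rfl, MOut_none s' hl' hN' hz', ?_⟩
        rw [p3' hz'] at hx
        rw [q3' hz'] at hy
        generalize edrop (N - (m + k)) G = D at *
        have e1 : ol + (D.len - m) = ol := by omega
        have e2 : D.lev + (m + k - D.len) = D.lev + (m - D.len) + k := by omega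
        rw [e1, e2]
        rw [e2] at q2
        exact .key _ _ _ _ ht hx hy p2 hr2 q2 h2
      · refine ⟨_, _, MOut_some s hl hN hz (big p1 q1) rfl,
          MOut_some s' hl' hN' hz' (big p1' q1') rfl, ?_⟩
        generalize edrop (N - (m + k)) G = D at *
        generalize edrop (N - (m' + k)) G' = D' at *
        obtain ⟨e1, j, hj, hj'⟩ := arith_both ol d1 d2 hlen (hl.trans hN) (hl'.trans hN') hz hz'
        rw [e1, hj, hj', ← Nat.add_assoc, ← Nat.add_assoc]
        rw [hj, ← Nat.add_assoc] at q2
        rw [hj', ← Nat.add_assoc] at q2'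
        exact .key _ _ _ _ ht hx hy p2 p2' q2 q2'

def Joins (e e' : Env) : Prop :=
  ∃ f f', ReflTransGen SRE e f ∧ ReflTransGen SRE e' f' ∧ HSim f f'

theorem joins_merge {e1 e1' e2 e2' : Env} {nl ol : Nat} (h : WfEnv (.merge e1 nl ol e2))
    (h' : WfEnv (.merge e1' nl ol e2')) (j1 : Joins e1 e1') (j2 : Joins e2 e2') :
    Joins (.merge e1 nl ol e2) (.merge e1' nl ol e2') := by
  obtain ⟨f, f', r, r', hf⟩ := j1
  obtain ⟨g, g', s, s', hg⟩ := j2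
  cases h with
  | merge _ _ ha hb hl hn =>
  cases h' with
  | merge _ _ ha' hb' hl' hn' =>
  have w1 := SREs_wf r ha
  have w1' := SREs_wf r' ha'
  have w2 := SREs_wf s hb
  have w2' := SREs_wf s' hb'
  obtain ⟨x, x', ⟨o, _, _⟩, ⟨o', _, _⟩, hx⟩ :=
    merge_HSim hf nl nl nl g g' hg (Nat.le_refl _) (Nat.le_refl _) (by omega) (by omega)
  rw [Nat.sub_self] at o o'
  have c : (edrop 0 g).len = ol := by simp only [edrop]; omega
  have c' : (edrop 0 g').len = ol := by simp only [edrop]; omega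
  rw [c] at o
  rw [c'] at o'
  exact ⟨x, x', (steps_merge nl ol r s).trans o, (steps_merge nl ol r' s').trans o', hx⟩

theorem joins_econs {t t' : Tm} {e e' : Env} {n : Nat} (h : WfEnv (.econs t n e))
    (h' : WfEnv (.econs t' n e')) (ht : SimT t t') (j : Joins e e') :
    Joins (.econs t n e) (.econs t' n e') := by
  obtain ⟨f, f', r, r', hf⟩ := j
  cases h with
  | econs _ _ he hl =>
  cases h' with
  | econs _ _ he' hl' =>
  have w := SREs_wf r he
  have w' := SREs_wf r' he'
  exact ⟨_, _, steps_consE _ _ r, steps_consE _ _ r', .econs n ht hf (by omega) (by omega)⟩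

theorem joins_refl : ∀ e : Env, WfEnv e → Joins e e
  | .nil, _ => ⟨_, _, .refl, .refl, .nil⟩
  | .econs t n e, h => by
    have j : Joins e e := by
      cases h with
      | econs _ _ he _ => exact joins_refl e he
    exact joins_econs h h (.refl t) j
  | .merge e1 nl ol e2, h => by
    have j : Joins e1 e1 ∧ Joins e2 e2 := by
      cases h with
      | merge _ _ ha hb _ _ => exact ⟨joins_refl e1 ha, joins_refl e2 hb⟩
    exact joins_merge h h j.1 j.2

theorem joins_of_sim : ∀ {e e' : Env}, SimE e e' → WfEnv e → WfEnv e' → Joins e e'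
  | _, _, .refl e, h, _ => joins_refl e h
  | _, _, .econs (e := e) (e' := e') n h1 h2, h, h' => by
    have j : Joins e e' := by
      cases h with
      | econs _ _ he _ =>
      cases h' with
      | econs _ _ he' _ => exact joins_of_sim h2 he he'
    exact joins_econs h h' h1 j
  | _, _, .merge (e1 := e1) (e1' := e1') (e2 := e2) (e2' := e2') nl ol h1 h2, h, h' => by
    have j : Joins e1 e1' ∧ Joins e2 e2' := by
      cases h with
      | merge _ _ ha hb _ _ =>
      cases h' with
      | merge _ _ ha' hb' _ _ => exact ⟨joins_of_sim h1 ha ha', joins_of_sim h2 hb hb'⟩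
    exact joins_merge h h' j.1 j.2
  | _, _, .key ol nl nl' k h1 h2 h3, h, h' => by
    cases h with
    | econs _ ht he hl =>
    cases h' with
    | econs _ ht' he' hl' =>
    cases ht with
    | susp _ _ ht hr hol hnl =>
    cases ht' with
    | susp _ _ ht' hr' hol' hnl' =>
    obtain ⟨f, f', r, r', hf⟩ := joins_of_sim h3 he he'
    obtain ⟨g, g', s, s', hg⟩ := joins_of_sim h2 hr hr'
    have w := SREs_wf r he
    have w' := SREs_wf r' he'
    have v := SREs_wf s hr
    have v' := SREs_wf s' hr'
    exact ⟨_, _, (steps_consE _ _ r).trans (steps_suspE _ _ _ _ _ s),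
      (steps_consE _ _ r').trans (steps_suspE _ _ _ _ _ s'),
      .key ol nl nl' k h1 hg hf (by omega) (by omega) (by omega) (by omega)⟩

/-- similarity is preserved into normal forms: similar
well-formed terms have the same (unique) normal form with respect to the
reading and merging rules, and similar well-formed environments rewrite to
similar simple environments. -/
theorem similarity_preserved_into_normal_forms :
    (∀ t t' u u' : Tm, WfTm t → WfTm t' → SimT t t' →
        Relation.ReflTransGen SR t u → Relation.ReflTransGen SR t' u' →
        NormalT u → NormalT u' → u = u') ∧
    (∀ e e' : Env, WfEnv e → WfEnv e' → SimE e e' →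
        ∃ f f' : Env, Relation.ReflTransGen SRE e f ∧
          Relation.ReflTransGen SRE e' f' ∧
          SimpleEnv f ∧ SimpleEnv f' ∧ SimE f f') := by
  refine ⟨fun t t' u u' ht ht' hs h h' n n' => ?_, fun e e' he he' hs => ?_⟩
  · obtain ⟨w, d⟩ := SRs_den h ht
    obtain ⟨w', d'⟩ := SRs_den h' ht'
    exact normal_inj u u' w w' n n' (by rw [← d, ← d', SimT_den hs ht ht'])
  · obtain ⟨f, f', r, r', hf⟩ := joins_of_sim hs he he'
    exact ⟨f, f', r, r', hf.srt.1.simple, hf.srt.2.1.simple, hf.simE⟩
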